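/- For any μ₀, μ₁ ∈ 𝓜, any λ, s ∈ [0,1] and any x₀, x₁ ∈ ℝ, writing μ_λ = (1−λ)μ₀ + λμ₁ and x_λ = (1−λ)x₀ + λx₁, one has Φ_{μ_λ}(s, x_λ) ≤ (1−λ) Φ_{μ₀}(s, x₀) + λ Φ_{μ₁}(s, x₁). -/

import Mathlib

open MeasureTheory ProbabilityTheory Real Set Filter

noncomputable section

/-- `ξ(s) = ∑_{p≥2} β_p² s^p` (we use `β : ℕ → ℝ` with `β 0 = β 1 = 0`). -/
def xiFn (β : ℕ → ℝ) (s : ℝ) : ℝ := ∑' p : ℕ, β p ^ 2 * s ^ p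

/-- `ξ'(s)`. -/
def xiD (β : ℕ → ℝ) (s : ℝ) : ℝ := ∑' p : ℕ, (p : ℝ) * β p ^ 2 * s ^ (p - 1)

/-- `ζ(s) = ξ''(s)`. -/
def zetaFn (β : ℕ → ℝ) (s : ℝ) : ℝ :=
  ∑' p : ℕ, (p : ℝ) * ((p : ℝ) - 1) * β p ^ 2 * s ^ (p - 2)

/-- admissible sequence of temperature parameters -/
def ValidBeta (β : ℕ → ℝ) : Prop :=
  β 0 = 0 ∧ β 1 = 0 ∧ (∀ p, 0 ≤ β p) ∧ (∃ p, 2 ≤ p ∧ 0 < β p) ∧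
    Summable fun p : ℕ => (2 : ℝ) ^ p * β p ^ 2

/-- membership in `𝓜`: a Borel probability measure concentrated on `[0,1]` -/
def MemM (μ : Measure ℝ) : Prop := IsProbabilityMeasure μ ∧ μ (Icc (0 : ℝ) 1)ᶜ = 0

/-- member of `𝓜_d`: finitely supported -/
def FinSupp (μ : Measure ℝ) : Prop := ∃ S : Finset ℝ, μ ((S : Set ℝ))ᶜ = 0

/-- the distribution function `α(s) = μ([0,s])` -/
def distF (μ : Measure ℝ) (s : ℝ) : ℝ := (μ (Icc 0 s)).toReal

/-- the metric `d(μ,ν) = ∫_0^1 |μ([0,s]) - ν([0,s])| ds` -/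
def dM (μ ν : Measure ℝ) : ℝ := ∫ s in (0 : ℝ)..1, |distF μ s - distF ν s|

/-- the smallest atom of `μ` strictly after `s` (or `1` if there is none) -/
def nextPt (μ : Measure ℝ) (s : ℝ) : ℝ :=
  sInf ({q : ℝ | s < q ∧ q ≤ 1 ∧ μ {q} ≠ 0} ∪ {1})

/-- one step of the backward recursion defining the Parisi PDE solution:
`(1/m) log E exp (m Φ(t, x + z √(ξ'(t) - ξ'(s))))`, interpreted as
`E Φ(t, x + z √(ξ'(t) - ξ'(s)))` when `m = 0`. -/
def gStep (β : ℕ → ℝ) (Φ : ℝ → ℝ → ℝ) (m t s x : ℝ) : ℝ :=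
  if m = 0 then ∫ z, Φ t (x + z * Real.sqrt (xiD β t - xiD β s)) ∂(gaussianReal 0 1)
  else m⁻¹ * Real.log
    (∫ z, Real.exp (m * Φ t (x + z * Real.sqrt (xiD β t - xiD β s))) ∂(gaussianReal 0 1))

/-- `Φ` is the Parisi PDE solution of a finitely supported `μ`. -/
def IsAtomicSol (β : ℕ → ℝ) (μ : Measure ℝ) (Φ : ℝ → ℝ → ℝ) : Prop :=
  (∀ x : ℝ, Φ 1 x = Real.log (Real.cosh x)) ∧
  (∀ s ∈ Ico (0 : ℝ) 1, ∀ x : ℝ, Φ s x = gStep β Φ (distF μ s) (nextPt μ s) s x)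

/-- `Φ` is the Parisi family `μ ↦ Φ_μ`: it satisfies the backward recursion on `𝓜_d`
and is `d`-continuous on `𝓜` (uniformly in `(s,x) ∈ [0,1] × ℝ`). -/
def IsParisiFamily (β : ℕ → ℝ) (Φ : Measure ℝ → ℝ → ℝ → ℝ) : Prop :=
  (∀ μ, MemM μ → FinSupp μ → IsAtomicSol β μ (Φ μ)) ∧
  (∀ μ, MemM μ → ∀ ε : ℝ, 0 < ε → ∃ δ : ℝ, 0 < δ ∧ ∀ ν, MemM ν → dM μ ν < δ →
      ∀ s ∈ Icc (0 : ℝ) 1, ∀ x : ℝ, |Φ μ s x - Φ ν s x| < ε)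

/-- `B` is a standard Brownian motion under `P`. -/
def IsStdBM {Ω : Type*} [MeasurableSpace Ω] (P : Measure Ω) (B : ℝ → Ω → ℝ) : Prop :=
  (∀ t : ℝ, Measurable (B t)) ∧
  (∀ᵐ ω ∂P, B 0 ω = 0) ∧
  (∀ᵐ ω ∂P, Continuous fun t => B t ω) ∧
  (∀ s t : ℝ, 0 ≤ s → s ≤ t →
    Measure.map (fun ω => B t ω - B s ω) P = gaussianReal 0 (Real.toNNReal (t - s))) ∧
  (∀ s t : ℝ, 0 ≤ s → s ≤ t →
    Indep (MeasurableSpace.comap (fun ω => B t ω - B s ω) inferInstance)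
      (⨆ v ∈ Icc (0 : ℝ) s, MeasurableSpace.comap (B v) inferInstance) P)

/-- the space `𝓓[s,t]`: progressively measurable processes bounded by `1` on `[s,t]` -/
def InD {Ω : Type*} {mΩ : MeasurableSpace Ω} (𝓕 : Filtration ℝ mΩ) (s t : ℝ)
    (u : ℝ → Ω → ℝ) : Prop :=
  ProgMeasurable 𝓕 u ∧ ∀ r ∈ Icc s t, ∀ ω, |u r ω| ≤ 1

/-- the norm `‖u‖ = (E ∫_s^t u(r)² dr)^{1/2}` on `𝓓[s,t]` -/
def normD {Ω : Type*} [MeasurableSpace Ω] (P : Measure Ω) (s t : ℝ)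
    (u : ℝ → Ω → ℝ) : ℝ :=
  Real.sqrt (∫ ω, (∫ r in s..t, (u r ω) ^ 2) ∂P)

/-- the functional
`F^{s,t}(u,x) = E[Φ_μ(t, x + ∫_s^t α ζ u dr + W(t) - W(s)) - (1/2)∫_s^t α ζ u² dr]`,
where `W r = B (ξ' r)`. -/
def Ffn {Ω : Type*} [MeasurableSpace Ω] (P : Measure Ω) (β : ℕ → ℝ) (μ : Measure ℝ)
    (Φ : ℝ → ℝ → ℝ) (W : ℝ → Ω → ℝ) (s t : ℝ) (u : ℝ → Ω → ℝ) (x : ℝ) : ℝ :=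
  ∫ ω, (Φ t (x + (∫ r in s..t, distF μ r * zetaFn β r * u r ω) + (W t ω - W s ω))
      - (1 / 2) * ∫ r in s..t, distF μ r * zetaFn β r * (u r ω) ^ 2) ∂P



/-! ### Gaussian preliminaries -/

/-- continuous functions of at most linear growth -/
def PzLG (g : ℝ → ℝ) : Prop := Continuous g ∧ ∃ K c : ℝ, ∀ z, |g z| ≤ K + c * |z|

lemma pz_int_exp (c : ℝ) : Integrable (fun z : ℝ => Real.exp (c * |z|)) (gaussianReal 0 1) := by
  have h1 := integrable_exp_mul_gaussianReal (μ := 0) (v := 1) c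
  have h2 := integrable_exp_mul_gaussianReal (μ := 0) (v := 1) (-c)
  refine (h1.add h2).mono' (by fun_prop) (ae_of_all _ fun z => ?_)
  rw [Real.norm_eq_abs, abs_of_pos (Real.exp_pos _)]
  rcases abs_cases z with ⟨h, _⟩ | ⟨h, _⟩ <;> rw [h]
  · simpa using (Real.exp_pos _).le
  · simpa using (Real.exp_pos _).le

lemma pz_int_of_bound {f : ℝ → ℝ} (hf : Continuous f) (K c : ℝ)
    (h : ∀ z, |f z| ≤ K * Real.exp (c * |z|)) : Integrable f (gaussianReal 0 1) :=
  ((pz_int_exp c).const_mul K).mono' hf.aestronglyMeasurable (ae_of_all _ h)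

lemma PzLG.int_exp {g : ℝ → ℝ} (hg : PzLG g) :
    Integrable (fun z => Real.exp (g z)) (gaussianReal 0 1) := by
  obtain ⟨hc, K, c, h⟩ := hg
  refine pz_int_of_bound (by fun_prop) (Real.exp K) c fun z => ?_
  rw [abs_of_pos (Real.exp_pos _), ← Real.exp_add]
  exact Real.exp_le_exp.2 ((le_abs_self _).trans (h z))

lemma PzLG.int {g : ℝ → ℝ} (hg : PzLG g) : Integrable g (gaussianReal 0 1) := by
  obtain ⟨hc, K, c, h⟩ := hg
  refine pz_int_of_bound (by fun_prop) (Real.exp K) c fun z => ?_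
  rw [← Real.exp_add]
  have := Real.add_one_le_exp (K + c * |z|)
  linarith [h z]

lemma PzLG.pos {g : ℝ → ℝ} (hg : PzLG g) :
    0 < ∫ z, Real.exp (g z) ∂(gaussianReal 0 1) := integral_exp_pos hg.int_exp

lemma PzLG.add {f g : ℝ → ℝ} (hf : PzLG f) (hg : PzLG g) : PzLG (fun z => f z + g z) := by
  obtain ⟨hc, K, c, h⟩ := hf
  obtain ⟨hc', K', c', h'⟩ := hg
  refine ⟨by fun_prop, K + K', c + c', fun z => ?_⟩
  have := abs_add_le (f z) (g z)
  linarith [h z, h' z]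

lemma PzLG.smul {f : ℝ → ℝ} (hf : PzLG f) (a : ℝ) : PzLG (fun z => a * f z) := by
  obtain ⟨hc, K, c, h⟩ := hf
  refine ⟨by fun_prop, |a| * K, |a| * c, fun z => ?_⟩
  rw [abs_mul]
  have := mul_le_mul_of_nonneg_left (h z) (abs_nonneg a)
  linarith

lemma pz_LG_const (a : ℝ) : PzLG (fun _ => a) := ⟨by fun_prop, |a|, 0, fun z => by simp⟩

lemma pz_LG_id : PzLG (fun z => z) := ⟨by fun_prop, 0, 1, fun z => by simp⟩

/-- `1`-Lipschitz functions -/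
def PzLip (A : ℝ → ℝ) : Prop := ∀ x y, |A x - A y| ≤ |x - y|

lemma PzLip.cont {A : ℝ → ℝ} (hA : PzLip A) : Continuous A := by
  have : LipschitzWith 1 A := LipschitzWith.of_dist_le_mul fun x y => by
    simpa [Real.dist_eq] using hA x y
  exact this.continuous

lemma PzLip.lg {A : ℝ → ℝ} (hA : PzLip A) (x r : ℝ) : PzLG (fun z => A (x + z * r)) := by
  refine ⟨by have := hA.cont; fun_prop, |A x|, |r|, fun z => ?_⟩
  have h1 := hA (x + z * r) x
  have h2 : |x + z * r - x| = |r| * |z| := by rw [← abs_mul]; ring_nf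
  have h3 := abs_sub_abs_le_abs_sub (A (x + z * r)) (A x)
  linarith

lemma pz_girsanov (f : ℝ → ℝ) (c : ℝ) :
    ∫ z, f z ∂(gaussianReal 0 1)
      = ∫ z, f (z + c) * Real.exp (-c * z - c ^ 2 / 2) ∂(gaussianReal 0 1) := by
  rw [integral_gaussianReal_eq_integral_smul (by simp),
    integral_gaussianReal_eq_integral_smul (by simp),
    ← integral_add_right_eq_self (fun z => gaussianPDFReal 0 1 z • f z) c]
  congr 1
  ext z
  simp only [gaussianPDFReal, smul_eq_mul]
  have : Real.exp (-(z + c - 0) ^ 2 / (2 * ((1 : NNReal) : ℝ)))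
      = Real.exp (-(z - 0) ^ 2 / (2 * ((1 : NNReal) : ℝ))) * Real.exp (-c * z - c ^ 2 / 2) := by
    rw [← Real.exp_add]
    congr 1
    simp
    ring
  rw [this]
  ring

lemma pz_gauss_scale (f : ℝ → ℝ) (hf : Continuous f) (x r : ℝ) (v : NNReal) (hr : r ^ 2 = v) :
    ∫ z, f (x + z * r) ∂(gaussianReal 0 1) = ∫ z, f (x + z) ∂(gaussianReal 0 v) := by
  have h := gaussianReal_map_mul_const (μ := 0) (v := 1) r
  have hv : (NNReal.mk (r ^ 2) (sq_nonneg r)) * 1 = v := by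
    ext; simpa using hr
  rw [hv, mul_zero] at h
  rw [← h, integral_map (by fun_prop) (by fun_prop)]

/-- adding independent Gaussians -/
lemma pz_conv (f : ℝ → ℝ) (hf : Continuous f) (x v w : ℝ) (hv : 0 ≤ v) (hw : 0 ≤ w)
    (hi : Integrable (fun z => f (x + z * √(v + w))) (gaussianReal 0 1)) :
    ∫ z, (∫ y, f (x + z * √v + y * √w) ∂(gaussianReal 0 1)) ∂(gaussianReal 0 1)
      = ∫ z, f (x + z * √(v + w)) ∂(gaussianReal 0 1) := by
  have e1 : ∀ z, ∫ y, f (x + z * √v + y * √w) ∂(gaussianReal 0 1)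
      = ∫ y, f (x + z * √v + y) ∂(gaussianReal 0 w.toNNReal) := fun z =>
    pz_gauss_scale f hf _ _ _ (by rw [Real.sq_sqrt hw, Real.coe_toNNReal _ hw])
  have hvw : (√(v + w)) ^ 2 = ((v.toNNReal + w.toNNReal : NNReal) : ℝ) := by
    rw [Real.sq_sqrt (by positivity)]; simp [hv, hw]
  have hmap : ∀ (r : ℝ) (u : NNReal), r ^ 2 = u →
      (gaussianReal 0 1).map (fun z => z * r) = gaussianReal 0 u := by
    intro r u hr
    have h := gaussianReal_map_mul_const (μ := 0) (v := 1) r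
    have hv : (NNReal.mk (r ^ 2) (sq_nonneg r)) * 1 = u := by
      ext; simpa using hr
    rw [hv, mul_zero] at h
    exact h
  have hi2 : Integrable (fun z => f (x + z)) (gaussianReal 0 (v.toNNReal + w.toNNReal)) := by
    rw [← hmap _ _ hvw, integrable_map_measure (by fun_prop) (by fun_prop)]
    exact hi
  have hconv := gaussianReal_conv_gaussianReal (m₁ := 0) (m₂ := 0) (v₁ := v.toNNReal)
    (v₂ := w.toNNReal)
  rw [add_zero] at hconv
  rw [pz_gauss_scale f hf x _ _ hvw, ← hconv, integral_conv (by rw [hconv]; exact hi2)]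
  simp_rw [e1]
  rw [← hmap (√v) v.toNNReal (by rw [Real.sq_sqrt hv, Real.coe_toNNReal _ hv]),
    integral_map (by fun_prop)]
  · simp only [add_assoc]
  · have : StronglyMeasurable (fun p : ℝ × ℝ => f (x + (p.1 + p.2))) :=
      (by fun_prop : Continuous fun p : ℝ × ℝ => f (x + (p.1 + p.2))).stronglyMeasurable
    exact (this.integral_prod_right (ν := gaussianReal 0 w.toNNReal)).aestronglyMeasurable

/-! ### The one-step operator -/

/-- `(1/m) log E exp (m A(x + z √v))` -/
def PzT (m v : ℝ) (A : ℝ → ℝ) (x : ℝ) : ℝ :=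
  m⁻¹ * Real.log (∫ z, Real.exp (m * A (x + z * √v)) ∂(gaussianReal 0 1))

lemma pz_T_exp {m : ℝ} (hm : 0 < m) (v : ℝ) {A : ℝ → ℝ} (hA : PzLip A) (x : ℝ) :
    Real.exp (m * PzT m v A x) = ∫ z, Real.exp (m * A (x + z * √v)) ∂(gaussianReal 0 1) := by
  rw [PzT, mul_inv_cancel_left₀ hm.ne', Real.exp_log ((hA.lg x (√v)).smul m).pos]

lemma pz_T_shift {m : ℝ} (hm : 0 < m) (v : ℝ) {A : ℝ → ℝ} (hA : PzLip A) (x b : ℝ) :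
    ∫ z, Real.exp (m * (A (x + z * √v) - b)) ∂(gaussianReal 0 1)
      = Real.exp (m * (PzT m v A x - b)) := by
  rw [mul_sub, sub_eq_add_neg, Real.exp_add, pz_T_exp hm v hA, ← integral_mul_const]
  congr 1
  ext z
  rw [← Real.exp_add]
  ring_nf

lemma pz_T_le {m : ℝ} (hm : 0 < m) (v : ℝ) {A : ℝ → ℝ} (hA : PzLip A) (x b : ℝ)
    (h : ∫ z, Real.exp (m * (A (x + z * √v) - b)) ∂(gaussianReal 0 1) ≤ 1) :
    PzT m v A x ≤ b := by
  rw [pz_T_shift hm v hA, Real.exp_le_one_iff] at h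
  nlinarith

lemma pz_T_norm {m : ℝ} (hm : 0 < m) (v : ℝ) {A : ℝ → ℝ} (hA : PzLip A) (x : ℝ) :
    ∫ z, Real.exp (m * (A (x + z * √v) - PzT m v A x)) ∂(gaussianReal 0 1) = 1 := by
  rw [pz_T_shift hm v hA]; simp

lemma pz_T_int {m : ℝ} (v : ℝ) {A : ℝ → ℝ} (hA : PzLip A) (x b : ℝ) :
    Integrable (fun z => Real.exp (m * (A (x + z * √v) - b))) (gaussianReal 0 1) := by
  have := (((hA.lg x (√v)).add (pz_LG_const (-b))).smul m).int_exp
  simpa only [sub_eq_add_neg] using this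

lemma pz_T_lip {m : ℝ} (hm : 0 < m) (v : ℝ) {A : ℝ → ℝ} (hA : PzLip A) : PzLip (PzT m v A) := by
  have key : ∀ x y, PzT m v A x ≤ PzT m v A y + |x - y| := by
    intro x y
    apply pz_T_le hm v hA
    rw [← pz_T_norm hm v hA y]
    refine integral_mono (pz_T_int v hA _ _) (pz_T_int v hA _ _) fun z => ?_
    apply Real.exp_le_exp.2
    apply mul_le_mul_of_nonneg_left _ hm.le
    have := (le_abs_self _).trans (hA (x + z * √v) (y + z * √v))
    rw [add_sub_add_right_eq_sub] at this
    linarith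
  intro x y
  rw [abs_le]
  have h1 := key x y
  have h2 := key y x
  rw [abs_sub_comm] at h2
  constructor <;> linarith

lemma pz_T_semigroup {m : ℝ} (hm : 0 < m) {v w : ℝ} (hv : 0 ≤ v) (hw : 0 ≤ w)
    {A : ℝ → ℝ} (hA : PzLip A) : PzT m v (PzT m w A) = PzT m (v + w) A := by
  ext x
  rw [PzT, PzT]
  congr 2
  simp_rw [pz_T_exp hm w hA]
  have := hA.cont
  exact pz_conv (fun y => Real.exp (m * A y)) (by fun_prop) x v w hv hw
    ((hA.lg x _).smul m).int_exp

lemma pz_T_zero {m : ℝ} (hm : 0 < m) (A : ℝ → ℝ) : PzT m 0 A = A := by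
  ext x
  simp [PzT, hm.ne']

/-- regularity class: convex, `1`-Lipschitz, semiconcave with constant `C` -/
def PzReg (C : ℝ) (A : ℝ → ℝ) : Prop :=
  ConvexOn ℝ univ A ∧ PzLip A ∧ ∀ x h, A (x + h) + A (x - h) - 2 * A x ≤ C * h ^ 2

lemma pz_T_convex {m : ℝ} (hm : 0 < m) (v : ℝ) {A : ℝ → ℝ} (hA : PzLip A)
    (hc : ConvexOn ℝ univ A) : ConvexOn ℝ univ (PzT m v A) := by
  refine ⟨convex_univ, fun x _ y _ a b ha hb hab => ?_⟩
  simp only [smul_eq_mul]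
  apply pz_T_le hm v hA
  have e : a * (∫ z, Real.exp (m * (A (x + z * √v) - PzT m v A x)) ∂(gaussianReal 0 1))
      + b * (∫ z, Real.exp (m * (A (y + z * √v) - PzT m v A y)) ∂(gaussianReal 0 1)) = 1 := by
    rw [pz_T_norm hm v hA, pz_T_norm hm v hA]; linarith
  rw [← e, ← integral_const_mul, ← integral_const_mul,
    ← integral_add ((pz_T_int v hA _ _).const_mul a) ((pz_T_int v hA _ _).const_mul b)]
  refine integral_mono (pz_T_int v hA _ _)
    (((pz_T_int v hA _ _).const_mul a).add ((pz_T_int v hA _ _).const_mul b)) fun z => ?_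
  have h1 := hc.2 (mem_univ (x + z * √v)) (mem_univ (y + z * √v)) ha hb hab
  have h2 := convexOn_exp.2 (mem_univ (m * (A (x + z * √v) - PzT m v A x)))
    (mem_univ (m * (A (y + z * √v) - PzT m v A y))) ha hb hab
  simp only [smul_eq_mul] at h1 h2 ⊢
  refine le_trans (Real.exp_le_exp.2 ?_) h2
  have e2 : a * (x + z * √v) + b * (y + z * √v) = a * x + b * y + z * √v := by
    linear_combination (z * √v) * hab
  rw [e2] at h1
  have := mul_le_mul_of_nonneg_left h1 hm.le
  linarith

lemma pz_exp_chord (c : ℝ) (hc : 0 ≤ c) :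
    ∃ κ : ℝ, ∀ t, |t| ≤ c → Real.exp t ≤ Real.cosh c + κ * t := by
  rcases hc.eq_or_lt with rfl | hc
  · refine ⟨0, fun t ht => ?_⟩
    have : t = 0 := by simpa using ht
    simp [this]
  · refine ⟨Real.sinh c / c, fun t ht => ?_⟩
    obtain ⟨h1, h2⟩ := abs_le.1 ht
    have ha : 0 ≤ (c + t) / (2 * c) := div_nonneg (by linarith) (by linarith)
    have hb : 0 ≤ (c - t) / (2 * c) := div_nonneg (by linarith) (by linarith)
    have h := convexOn_exp.2 (mem_univ c) (mem_univ (-c)) ha hb (by field_simp; ring)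
    simp only [smul_eq_mul] at h
    have e : (c + t) / (2 * c) * c + (c - t) / (2 * c) * -c = t := by field_simp; ring
    rw [e] at h
    refine h.trans (le_of_eq ?_)
    rw [Real.cosh_eq, Real.sinh_eq]
    field_simp
    ring

lemma pz_T_semiconc {m C : ℝ} (hm : 0 < m) (v : ℝ) {A : ℝ → ℝ} (hA : PzLip A)
    (hs : ∀ x h, A (x + h) + A (x - h) - 2 * A x ≤ C * h ^ 2) (x h : ℝ) :
    PzT m v A (x + h) + PzT m v A (x - h) - 2 * PzT m v A x ≤ (C + m) * h ^ 2 := by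
  set τ := PzT m v A x with hτ
  set p : ℝ → ℝ := fun z => Real.exp (m * (A (x + z * √v) - τ)) with hp
  set δ : ℝ → ℝ := fun z => A (x + h + z * √v) - A (x + z * √v) with hδ
  have hAc := hA.cont
  have hδb : ∀ z, |δ z| ≤ |h| := fun z => by
    have := hA (x + h + z * √v) (x + z * √v)
    rwa [show x + h + z * √v - (x + z * √v) = h by ring] at this
  have hpI : Integrable p (gaussianReal 0 1) := pz_T_int v hA _ _
  have hp1 : ∫ z, p z ∂(gaussianReal 0 1) = 1 := pz_T_norm hm v hA x
  have hpδ : Integrable (fun z => p z * δ z) (gaussianReal 0 1) := by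
    refine (hpI.mul_const |h|).mono' (by fun_prop) (ae_of_all _ fun z => ?_)
    rw [Real.norm_eq_abs, abs_mul, abs_of_pos (Real.exp_pos _)]
    exact mul_le_mul_of_nonneg_left (hδb z) (Real.exp_pos _).le
  obtain ⟨κ, hκ⟩ := pz_exp_chord (m * |h|) (by positivity)
  set M := ∫ z, p z * δ z ∂(gaussianReal 0 1) with hM
  set ch := Real.cosh (m * |h|) with hch
  have hmδ : ∀ z, |m * δ z| ≤ m * |h| := fun z => by
    rw [abs_mul, abs_of_pos hm]; exact mul_le_mul_of_nonneg_left (hδb z) hm.le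
  have E1 : Real.exp (m * (PzT m v A (x + h) - τ)) ≤ ch + κ * m * M := by
    rw [← pz_T_shift hm v hA]
    have : ch + κ * m * M = ∫ z, (ch * p z + κ * m * (p z * δ z)) ∂(gaussianReal 0 1) := by
      rw [integral_add (hpI.const_mul _) (hpδ.const_mul _), integral_const_mul,
        integral_const_mul, hp1, mul_one]
    rw [this]
    refine integral_mono (pz_T_int v hA _ _) ((hpI.const_mul _).add (hpδ.const_mul _)) fun z => ?_
    have h1 := mul_le_mul_of_nonneg_left (hκ (m * δ z) (hmδ z)) (Real.exp_pos
      (m * (A (x + z * √v) - τ))).le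
    rw [← Real.exp_add] at h1
    have e : m * (A (x + z * √v) - τ) + m * δ z = m * (A (x + h + z * √v) - τ) := by
      simp only [hδ]; ring
    rw [e] at h1
    simp only [hp]
    linarith
  have E2 : Real.exp (m * (PzT m v A (x - h) - τ)) ≤
      Real.exp (m * (C * h ^ 2)) * (ch - κ * m * M) := by
    rw [← pz_T_shift hm v hA]
    have : Real.exp (m * (C * h ^ 2)) * (ch - κ * m * M) =
        ∫ z, (Real.exp (m * (C * h ^ 2)) * (ch * p z - κ * m * (p z * δ z)))
          ∂(gaussianReal 0 1) := by
      rw [integral_const_mul, integral_sub (hpI.const_mul _) (hpδ.const_mul _),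
        integral_const_mul, integral_const_mul, hp1, mul_one]
    rw [this]
    refine integral_mono (pz_T_int v hA _ _)
      (((hpI.const_mul _).sub (hpδ.const_mul _)).const_mul _) fun z => ?_
    have h1 := mul_le_mul_of_nonneg_left (hκ (-(m * δ z)) (by rw [abs_neg]; exact hmδ z))
      (Real.exp_pos (m * (A (x + z * √v) - τ))).le
    have h2 := mul_le_mul_of_nonneg_left h1 (Real.exp_pos (m * (C * h ^ 2))).le
    rw [← Real.exp_add, ← Real.exp_add] at h2
    have h3 := hs (x + z * √v) h
    rw [show x + z * √v + h = x + h + z * √v by ring,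
      show x + z * √v - h = x - h + z * √v by ring] at h3
    have h4 := mul_le_mul_of_nonneg_left h3 hm.le
    refine (Real.exp_le_exp.2 ?_).trans (h2.trans (le_of_eq ?_))
    · simp only [hδ]; linarith
    · simp only [hp]; ring
  have hcp : 0 ≤ ch := (Real.cosh_pos _).le
  have hprod : Real.exp (m * (PzT m v A (x + h) - τ)) * Real.exp (m * (PzT m v A (x - h) - τ))
      ≤ Real.exp (m * (C * h ^ 2)) * ch ^ 2 := by
    refine (mul_le_mul E1 E2 (Real.exp_pos _).le ((Real.exp_pos _).le.trans E1)).trans ?_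
    have := mul_nonneg (Real.exp_pos (m * (C * h ^ 2))).le (sq_nonneg (κ * m * M))
    nlinarith
  have hch2 : ch ^ 2 ≤ Real.exp ((m * h) ^ 2) := by
    have h1 := Real.cosh_le_exp_half_sq (m * |h|)
    have h2 := pow_le_pow_left₀ hcp h1 2
    refine h2.trans (le_of_eq ?_)
    rw [← Real.exp_nat_mul]
    congr 1
    rw [mul_pow, sq_abs]
    push_cast
    ring
  have hfin := hprod.trans (mul_le_mul_of_nonneg_left hch2 (Real.exp_pos _).le)
  rw [← Real.exp_add, ← Real.exp_add, Real.exp_le_exp] at hfin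
  have : m * (PzT m v A (x + h) + PzT m v A (x - h) - 2 * τ) ≤ m * ((C + m) * h ^ 2) := by
    linarith
  exact le_of_mul_le_mul_left this hm

lemma pz_T_reg {m C : ℝ} (hm : 0 < m) (hm1 : m ≤ 1) (v : ℝ) {A : ℝ → ℝ} (hA : PzReg C A) :
    PzReg (C + 1) (PzT m v A) := by
  refine ⟨pz_T_convex hm v hA.2.1 hA.1, pz_T_lip hm v hA.2.1, fun x h => ?_⟩
  refine (pz_T_semiconc hm v hA.2.1 hA.2.2 x h).trans ?_
  exact mul_le_mul_of_nonneg_right (by linarith) (sq_nonneg h)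

lemma pz_reg_logcosh : PzReg 1 (fun x => Real.log (Real.cosh x)) := by
  have hle : ∀ x, x ≤ Real.log (2 * Real.cosh x) := fun x => by
    rw [Real.le_log_iff_exp_le (by have := Real.cosh_pos x; positivity), Real.cosh_eq]
    have := Real.exp_pos (-x)
    linarith
  refine ⟨⟨convex_univ, fun x _ y _ a b ha hb hab => ?_⟩, ?_, fun x h => ?_⟩
  · simp only [smul_eq_mul]
    rw [Real.log_le_iff_le_exp (Real.cosh_pos _)]
    set X := Real.log (Real.cosh x) with hX
    set Y := Real.log (Real.cosh y) with hY
    have hx : Real.exp (x - X) + Real.exp (-x - X) = 2 := by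
      rw [sub_eq_add_neg, sub_eq_add_neg, Real.exp_add, Real.exp_add, Real.exp_neg X, hX,
        Real.exp_log (Real.cosh_pos _), ← add_mul, ← div_eq_mul_inv, Real.cosh_eq]
      have := Real.exp_pos x
      have := Real.exp_pos (-x)
      field_simp
    have hy : Real.exp (y - Y) + Real.exp (-y - Y) = 2 := by
      rw [sub_eq_add_neg, sub_eq_add_neg, Real.exp_add, Real.exp_add, Real.exp_neg Y, hY,
        Real.exp_log (Real.cosh_pos _), ← add_mul, ← div_eq_mul_inv, Real.cosh_eq]
      have := Real.exp_pos y
      have := Real.exp_pos (-y)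
      field_simp
    have h1 := convexOn_exp.2 (mem_univ (x - X)) (mem_univ (y - Y)) ha hb hab
    have h2 := convexOn_exp.2 (mem_univ (-x - X)) (mem_univ (-y - Y)) ha hb hab
    simp only [smul_eq_mul] at h1 h2
    have e1 : a * (x - X) + b * (y - Y) = (a * x + b * y) - (a * X + b * Y) := by ring
    have e2 : a * (-x - X) + b * (-y - Y) = -(a * x + b * y) - (a * X + b * Y) := by ring
    rw [e1, Real.exp_sub] at h1
    rw [e2, Real.exp_sub] at h2
    have h3 : (Real.exp (a * x + b * y) + Real.exp (-(a * x + b * y))) / Real.exp (a * X + b * Y)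
        ≤ 2 := by
      rw [add_div]
      have : a * Real.exp (x - X) + a * Real.exp (-x - X) = 2 * a := by rw [← mul_add, hx]; ring
      have : b * Real.exp (y - Y) + b * Real.exp (-y - Y) = 2 * b := by rw [← mul_add, hy]; ring
      linarith
    rw [div_le_iff₀ (Real.exp_pos _)] at h3
    rw [Real.cosh_eq]
    linarith
  · have key : ∀ x y, Real.log (Real.cosh x) ≤ Real.log (Real.cosh y) + |x - y| := by
      intro x y
      rw [Real.log_le_iff_le_exp (Real.cosh_pos _), Real.exp_add, Real.exp_log (Real.cosh_pos _),
        Real.cosh_eq, Real.cosh_eq]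
      have h1 : Real.exp x ≤ Real.exp y * Real.exp |x - y| := by
        rw [← Real.exp_add]; exact Real.exp_le_exp.2 (by linarith [le_abs_self (x - y)])
      have h2 : Real.exp (-x) ≤ Real.exp (-y) * Real.exp |x - y| := by
        rw [← Real.exp_add]; exact Real.exp_le_exp.2 (by linarith [neg_abs_le (x - y)])
      linarith
    intro x y
    rw [abs_le]
    have h1 := key x y
    have h2 := key y x
    rw [abs_sub_comm] at h2
    constructor <;> linarith
  · have hc := Real.cosh_pos
    have h1 : Real.cosh (x + h) * Real.cosh (x - h) ≤ Real.cosh x ^ 2 * Real.cosh h ^ 2 := by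
      rw [Real.cosh_add, Real.cosh_sub]
      nlinarith [sq_nonneg (Real.sinh x * Real.sinh h)]
    have h2 := Real.log_le_log (mul_pos (hc _) (hc _)) h1
    rw [Real.log_mul (hc _).ne' (hc _).ne', Real.log_mul (pow_pos (hc _) 2).ne'
      (pow_pos (hc _) 2).ne', Real.log_pow, Real.log_pow] at h2
    have h3 : Real.log (Real.cosh h) ≤ h ^ 2 / 2 := by
      rw [Real.log_le_iff_le_exp (hc _)]; exact Real.cosh_le_exp_half_sq h
    push_cast at h2
    simp only
    linarith

/-! ### The approximate one-step inequality -/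

lemma pz_subgradient {A : ℝ → ℝ} (hc : ConvexOn ℝ univ A) (hA : PzLip A) (x : ℝ) :
    ∃ a : ℝ, |a| ≤ 1 ∧ ∀ w, A x + a * w ≤ A (x + w) := by
  have hx : x ∈ interior (univ : Set ℝ) := by simp
  set a := derivWithin A (Ioi x) x with ha
  have key : ∀ w, A x + a * w ≤ A (x + w) := by
    intro w
    rcases lt_trichotomy w 0 with hw | rfl | hw
    · have h1 := hc.slope_le_leftDeriv_of_mem_interior (mem_univ (x + w)) hx (by linarith)
      have h2 := h1.trans (hc.leftDeriv_le_rightDeriv_of_mem_interior hx)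
      rw [← ha, slope_def_field, div_le_iff₀ (by linarith)] at h2
      linarith
    · simp
    · have h1 := hc.rightDeriv_le_slope_of_mem_interior hx (mem_univ (x + w)) (by linarith)
      rw [← ha, slope_def_field, le_div_iff₀ (by linarith)] at h1
      linarith
  refine ⟨a, ?_, key⟩
  have h1 := key 1
  have h2 := key (-1)
  have h3 := (le_abs_self _).trans (hA (x + 1) x)
  have h4 := (le_abs_self _).trans (hA (x + -1) x)
  simp at h3 h4
  rw [abs_le]
  constructor <;> linarith

lemma pz_int3 {f g : ℝ → ℝ} (hf : Integrable f (gaussianReal 0 1))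
    (hg : Integrable g (gaussianReal 0 1)) (a b c : ℝ) :
    ∫ z, (a * f z + b * g z + c) ∂(gaussianReal 0 1)
      = a * (∫ z, f z ∂(gaussianReal 0 1)) + b * (∫ z, g z ∂(gaussianReal 0 1)) + c := by
  have h1 : Integrable (fun z => a * f z + b * g z) (gaussianReal 0 1) :=
    (hf.const_mul a).add (hg.const_mul b)
  rw [integral_add h1 (integrable_const _), integral_add (hf.const_mul a) (hg.const_mul b),
    integral_const_mul, integral_const_mul]
  simp

/-- Girsanov form of the one-step operator -/
lemma pz_T_girsanov {m h : ℝ} (hm : 0 < m) (hh : 0 ≤ h) {A : ℝ → ℝ} (hA : PzLip A) (x a : ℝ) :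
    Real.exp (m * PzT m h A x) = ∫ z, Real.exp (m * A (x + m * a * h + z * √h)
      - m * a * √h * z - m ^ 2 * a ^ 2 * h / 2) ∂(gaussianReal 0 1) := by
  rw [pz_T_exp hm h hA, pz_girsanov _ (m * a * √h)]
  congr 1
  ext z
  rw [← Real.exp_add]
  have hs : √h * √h = h := Real.mul_self_sqrt hh
  have e1 : x + (z + m * a * √h) * √h = x + m * a * h + z * √h := by
    linear_combination (m * a) * hs
  rw [e1]
  congr 1
  linear_combination (-m ^ 2 * a ^ 2 / 2) * hs

lemma pz_T_lower {m h : ℝ} (hm : 0 < m) (hh : 0 ≤ h) {A : ℝ → ℝ} (hA : PzLip A) (x a : ℝ) :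
    (∫ z, A (x + m * a * h + z * √h) ∂(gaussianReal 0 1)) - m * a ^ 2 * h / 2
      ≤ PzT m h A x := by
  set E := ∫ z, A (x + m * a * h + z * √h) ∂(gaussianReal 0 1) with hE
  have hAI := (hA.lg (x + m * a * h) (√h)).int
  have hZI := pz_LG_id.int
  have hZ : ∫ z, z ∂(gaussianReal 0 1) = 0 := integral_id_gaussianReal
  set b := m * E - m ^ 2 * a ^ 2 * h / 2 with hb
  have hlin : ∫ z, (Real.exp b * (1 + (m * A (x + m * a * h + z * √h)
      - m * a * √h * z - m ^ 2 * a ^ 2 * h / 2 - b))) ∂(gaussianReal 0 1) = Real.exp b := by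
    rw [integral_const_mul]
    have : ∀ z, 1 + (m * A (x + m * a * h + z * √h) - m * a * √h * z - m ^ 2 * a ^ 2 * h / 2 - b)
      = m * A (x + m * a * h + z * √h) + (-(m * a * √h)) * z
        + (1 - m ^ 2 * a ^ 2 * h / 2 - b) := fun z => by ring
    simp_rw [this]
    rw [pz_int3 hAI hZI, hZ, ← hE]
    simp [hb]
  have h1 : Real.exp b ≤ Real.exp (m * PzT m h A x) := by
    rw [pz_T_girsanov hm hh hA x a, ← hlin]
    refine integral_mono ?_ ?_ fun z => ?_
    · refine Integrable.const_mul ?_ _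
      refine (integrable_const _).add ?_
      exact ((((hAI.const_mul _).sub (hZI.const_mul _)).sub (integrable_const _))).sub
        (integrable_const _)
    · have := (((hA.lg (x + m * a * h) (√h)).smul m).add
        (pz_LG_id.smul (-(m * a * √h)))).add (pz_LG_const (-(m ^ 2 * a ^ 2 * h / 2)))
      refine this.int_exp.congr (ae_of_all _ fun z => ?_)
      simp only
      congr 1
      ring
    · simp only
      have h2 := Real.add_one_le_exp (m * A (x + m * a * h + z * √h)
        - m * a * √h * z - m ^ 2 * a ^ 2 * h / 2 - b)
      have h3 := mul_le_mul_of_nonneg_left h2 (Real.exp_pos b).le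
      rw [← Real.exp_add] at h3
      rw [add_comm (1 : ℝ)]
      refine h3.trans (le_of_eq ?_)
      congr 1
      ring
  rw [Real.exp_le_exp] at h1
  have : m * (E - m * a ^ 2 * h / 2) ≤ m * PzT m h A x := by rw [hb] at h1; linarith
  exact le_of_mul_le_mul_left this hm

/-- the moment constant -/
def pzK : ℝ := ∫ z, 24 * Real.exp (3 * (1 + |z|)) ∂(gaussianReal 0 1)

lemma pz_exp_taylor {t : ℝ} (ht : 0 ≤ t) : Real.exp t ≤ 1 + t + t ^ 2 * Real.exp t := by
  have h1 := Real.add_one_le_exp (-t)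
  have h2 : Real.exp t * Real.exp (-t) = 1 := by rw [← Real.exp_add]; simp
  have h3 := Real.exp_pos t
  by_cases h : 1 ≤ t
  · have : Real.exp t ≤ t ^ 2 * Real.exp t := le_mul_of_one_le_left h3.le (one_le_pow₀ h)
    linarith
  · push Not at h
    have h4 : Real.exp t * (1 - t) ≤ 1 := by nlinarith
    have h5 := mul_le_mul_of_nonneg_right h4 (by linarith : 0 ≤ 1 + t)
    nlinarith

lemma pz_pow_four {t : ℝ} (ht : 0 ≤ t) : t ^ 4 ≤ 24 * Real.exp t := by
  have := Real.pow_div_factorial_le_exp t ht 4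
  simp [Nat.factorial] at this
  linarith

lemma pz_T_upper {m h C : ℝ} (hm : 0 < m) (hm1 : m ≤ 1) (hh : 0 ≤ h) (hh1 : h ≤ 1)
    (hC : 0 ≤ C) {A : ℝ → ℝ} (hA : PzReg C A) (x : ℝ) :
    ∃ a : ℝ, PzT m h A x ≤ (∫ z, A (x + m * a * h + z * √h) ∂(gaussianReal 0 1))
      - m * a ^ 2 * h / 2 + C ^ 2 * pzK * h ^ 2 := by
  obtain ⟨hcv, hL, hsc⟩ := hA
  obtain ⟨a, ha, hsub⟩ := pz_subgradient hcv hL x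
  refine ⟨a, ?_⟩
  have hs : √h * √h = h := Real.mul_self_sqrt hh
  have hs0 := Real.sqrt_nonneg h
  have hs1 : √h ≤ 1 := Real.sqrt_le_one.2 hh1
  have hhs : h ≤ √h := by nlinarith
  set w : ℝ → ℝ := fun z => m * a * h + z * √h with hw
  set R : ℝ → ℝ := fun z => A (x + m * a * h + z * √h) - A x - a * w z with hR
  have hxw : ∀ z, x + m * a * h + z * √h = x + w z := fun z => by simp only [hw]; ring
  have hR0 : ∀ z, 0 ≤ R z := fun z => by
    have := hsub (w z)
    simp only [hR, hxw]; linarith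
  have hR2 : ∀ z, R z ≤ C * (w z) ^ 2 := fun z => by
    have h1 := hsub (-(w z))
    have h2 := hsc x (w z)
    rw [← sub_eq_add_neg] at h1
    simp only [hR, hxw]; linarith
  have hRl : ∀ z, R z ≤ 2 * |w z| := fun z => by
    have h1 := (le_abs_self _).trans (hL (x + w z) x)
    rw [add_sub_cancel_left] at h1
    have h2 : |a * w z| ≤ |w z| := by
      rw [abs_mul]; exact mul_le_of_le_one_left (abs_nonneg _) ha
    have h3 := neg_abs_le (a * w z)
    simp only [hR, hxw]; linarith
  have hwb : ∀ z, |w z| ≤ √h * (1 + |z|) := fun z => by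
    have h1 : |m * a * h| ≤ √h := by
      rw [abs_mul, abs_mul, abs_of_pos hm, abs_of_nonneg hh]
      have : m * |a| ≤ 1 := by nlinarith [abs_nonneg a]
      have := mul_le_mul_of_nonneg_right this hh
      linarith
    have h2 : |z * √h| = |z| * √h := by rw [abs_mul, abs_of_nonneg hs0]
    have := abs_add_le (m * a * h) (z * √h)
    simp only [hw]; linarith
  have hwb1 : ∀ z, |w z| ≤ 1 + |z| := fun z => by
    have := mul_le_mul_of_nonneg_right hs1 (by positivity : 0 ≤ 1 + |z|)
    linarith [hwb z]
  have hw4 : ∀ z, (w z) ^ 4 ≤ h ^ 2 * (1 + |z|) ^ 4 := fun z => by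
    have h1 := pow_le_pow_left₀ (abs_nonneg _) (hwb z) 4
    rw [mul_pow] at h1
    have e1 : |w z| ^ 4 = (w z) ^ 4 := by rw [← abs_pow, abs_of_nonneg (by positivity)]
    have e2 : √h ^ 4 = h ^ 2 := by linear_combination (√h * √h + h) * hs
    rwa [e1, e2] at h1
  have hAlg := hL.lg (x + m * a * h) (√h)
  have hRlg : PzLG R := by
    have h1 := (hAlg.add (pz_LG_const (-(A x) - a * (m * a * h)))).add (pz_LG_id.smul (-(a * √h)))
    convert h1 using 2
    simp only [hR, hw]; ring
  have hKI : Integrable (fun z => 24 * Real.exp (3 * (1 + |z|))) (gaussianReal 0 1) := by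
    have := (pz_int_exp 3).const_mul (24 * Real.exp 3)
    refine this.congr (ae_of_all _ fun z => ?_)
    simp only
    rw [mul_assoc, ← Real.exp_add]
    ring_nf
  -- pointwise bound
  have hpt : ∀ z, Real.exp (m * R z) ≤ 1 + m * R z
      + m * (C ^ 2 * h ^ 2) * (24 * Real.exp (3 * (1 + |z|))) := fun z => by
    have h0 := hR0 z
    have h1 := pz_exp_taylor (mul_nonneg hm.le h0)
    have h2 : (m * R z) ^ 2 ≤ m * (C ^ 2 * h ^ 2 * (1 + |z|) ^ 4) := by
      have h3 : (R z) ^ 2 ≤ C ^ 2 * (h ^ 2 * (1 + |z|) ^ 4) := by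
        calc (R z) ^ 2 ≤ (C * (w z) ^ 2) ^ 2 := pow_le_pow_left₀ h0 (hR2 z) 2
          _ = C ^ 2 * (w z) ^ 4 := by ring
          _ ≤ _ := mul_le_mul_of_nonneg_left (hw4 z) (sq_nonneg C)
      have h4 : m ^ 2 ≤ m := by nlinarith
      rw [mul_pow]
      calc m ^ 2 * R z ^ 2 ≤ m * (C ^ 2 * (h ^ 2 * (1 + |z|) ^ 4)) :=
            mul_le_mul h4 h3 (sq_nonneg _) hm.le
        _ = _ := by ring
    have h5 : Real.exp (m * R z) ≤ Real.exp (2 * (1 + |z|)) := by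
      apply Real.exp_le_exp.2
      have : m * R z ≤ 1 * R z := mul_le_mul_of_nonneg_right hm1 h0
      linarith [hRl z, hwb1 z]
    have h6 := pz_pow_four (by positivity : 0 ≤ 1 + |z|)
    have h7 : (1 + |z|) ^ 4 * Real.exp (2 * (1 + |z|)) ≤ 24 * Real.exp (3 * (1 + |z|)) := by
      have := mul_le_mul_of_nonneg_right h6 (Real.exp_pos (2 * (1 + |z|))).le
      rw [mul_assoc, ← Real.exp_add] at this
      refine this.trans (le_of_eq ?_)
      ring_nf
    have h8 : (m * R z) ^ 2 * Real.exp (m * R z)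
        ≤ m * (C ^ 2 * h ^ 2) * (24 * Real.exp (3 * (1 + |z|))) := by
      calc (m * R z) ^ 2 * Real.exp (m * R z)
          ≤ (m * (C ^ 2 * h ^ 2 * (1 + |z|) ^ 4)) * Real.exp (2 * (1 + |z|)) :=
            mul_le_mul h2 h5 (Real.exp_pos _).le (by positivity)
        _ = m * (C ^ 2 * h ^ 2) * ((1 + |z|) ^ 4 * Real.exp (2 * (1 + |z|))) := by ring
        _ ≤ _ := mul_le_mul_of_nonneg_left h7 (by positivity)
    linarith
  have hIntg : ∫ z, Real.exp (m * R z) ∂(gaussianReal 0 1)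
      ≤ 1 + m * (∫ z, R z ∂(gaussianReal 0 1)) + m * (C ^ 2 * h ^ 2) * pzK := by
    have e : 1 + m * (∫ z, R z ∂(gaussianReal 0 1)) + m * (C ^ 2 * h ^ 2) * pzK
        = ∫ z, (1 + m * R z + m * (C ^ 2 * h ^ 2) * (24 * Real.exp (3 * (1 + |z|))))
          ∂(gaussianReal 0 1) := by
      have h1 := pz_int3 hRlg.int hKI m (m * (C ^ 2 * h ^ 2)) 1
      rw [pzK]
      refine Eq.trans ?_ (h1.symm.trans ?_)
      · ring
      · congr 1
        ext z
        ring
    rw [e]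
    exact integral_mono (hRlg.smul m).int_exp
      (((integrable_const _).add (hRlg.int.const_mul _)).add (hKI.const_mul _)) hpt
  have hER : ∫ z, A (x + m * a * h + z * √h) ∂(gaussianReal 0 1)
      = A x + m * a ^ 2 * h + ∫ z, R z ∂(gaussianReal 0 1) := by
    have e : ∀ z, A (x + m * a * h + z * √h) = a * √h * z + 1 * R z + (A x + m * a ^ 2 * h) :=
      fun z => by simp only [hR, hw]; ring
    simp_rw [e]
    rw [pz_int3 pz_LG_id.int hRlg.int, integral_id_gaussianReal]
    ring
  have hexp : Real.exp (m * PzT m h A x) = Real.exp (m * A x + m ^ 2 * a ^ 2 * h / 2)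
      * ∫ z, Real.exp (m * R z) ∂(gaussianReal 0 1) := by
    rw [pz_T_girsanov hm hh hL x a, ← integral_const_mul]
    congr 1
    ext z
    rw [← Real.exp_add]
    congr 1
    simp only [hR, hw]; ring
  have hfin : Real.exp (m * PzT m h A x) ≤ Real.exp (m * A x + m ^ 2 * a ^ 2 * h / 2
      + (m * (∫ z, R z ∂(gaussianReal 0 1)) + m * (C ^ 2 * h ^ 2) * pzK)) := by
    rw [hexp, Real.exp_add _ (m * (∫ z, R z ∂(gaussianReal 0 1)) + m * (C ^ 2 * h ^ 2) * pzK)]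
    apply mul_le_mul_of_nonneg_left _ (Real.exp_pos _).le
    have := Real.add_one_le_exp (m * (∫ z, R z ∂(gaussianReal 0 1)) + m * (C ^ 2 * h ^ 2) * pzK)
    linarith
  rw [Real.exp_le_exp] at hfin
  rw [hER]
  refine le_of_mul_le_mul_left ?_ hm
  linarith

lemma pz_step_small {m0 m1 m l h C e : ℝ} (h0 : 0 < m0) (h1 : 0 < m1) (hm : 0 < m) (hm1 : m ≤ 1)
    (hl : l ∈ Icc (0 : ℝ) 1) (hml : m = (1 - l) * m0 + l * m1) (hh : 0 ≤ h) (hh1 : h ≤ 1)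
    (hC : 0 ≤ C) {A0 A1 A : ℝ → ℝ} (hA0 : PzLip A0) (hA1 : PzLip A1) (hA : PzReg C A)
    (H : ∀ x0 x1, A ((1 - l) * x0 + l * x1) ≤ (1 - l) * A0 x0 + l * A1 x1 + e) (x0 x1 : ℝ) :
    PzT m h A ((1 - l) * x0 + l * x1)
      ≤ (1 - l) * PzT m0 h A0 x0 + l * PzT m1 h A1 x1 + (e + C ^ 2 * pzK * h ^ 2) := by
  obtain ⟨hl0, hl1⟩ := hl
  obtain ⟨a, hu⟩ := pz_T_upper hm hm1 hh hh1 hC hA ((1 - l) * x0 + l * x1)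
  have L0 := mul_le_mul_of_nonneg_left (pz_T_lower h0 hh hA0 x0 a) (by linarith : 0 ≤ 1 - l)
  have L1 := mul_le_mul_of_nonneg_left (pz_T_lower h1 hh hA1 x1 a) hl0
  have I0 := (hA0.lg (x0 + m0 * a * h) (√h)).int
  have I1 := (hA1.lg (x1 + m1 * a * h) (√h)).int
  have hmid : ∫ z, A ((1 - l) * x0 + l * x1 + m * a * h + z * √h) ∂(gaussianReal 0 1)
      ≤ (1 - l) * (∫ z, A0 (x0 + m0 * a * h + z * √h) ∂(gaussianReal 0 1))
        + l * (∫ z, A1 (x1 + m1 * a * h + z * √h) ∂(gaussianReal 0 1)) + e := by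
    have eq : (1 - l) * (∫ z, A0 (x0 + m0 * a * h + z * √h) ∂(gaussianReal 0 1))
        + l * (∫ z, A1 (x1 + m1 * a * h + z * √h) ∂(gaussianReal 0 1)) + e
        = ∫ z, ((1 - l) * A0 (x0 + m0 * a * h + z * √h) + l * A1 (x1 + m1 * a * h + z * √h) + e)
          ∂(gaussianReal 0 1) := (pz_int3 I0 I1 _ _ _).symm
    rw [eq]
    refine integral_mono (hA.2.1.lg _ _).int
      (((I0.const_mul _).add (I1.const_mul _)).add (integrable_const _)) fun z => ?_
    have := H (x0 + m0 * a * h + z * √h) (x1 + m1 * a * h + z * √h)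
    refine le_trans (le_of_eq ?_) this
    congr 1
    rw [hml]; ring
  have hmm : m * a ^ 2 * h / 2 = (1 - l) * (m0 * a ^ 2 * h / 2) + l * (m1 * a ^ 2 * h / 2) := by
    rw [hml]; ring
  linarith

lemma pz_step {m0 m1 m l v C : ℝ} (h0 : 0 < m0) (h1 : 0 < m1) (hm : 0 < m) (hm1 : m ≤ 1)
    (hl : l ∈ Icc (0 : ℝ) 1) (hml : m = (1 - l) * m0 + l * m1) (hv : 0 ≤ v)
    (hC : 0 ≤ C) {A0 A1 A : ℝ → ℝ} (hA0 : PzLip A0) (hA1 : PzLip A1) (hA : PzReg C A)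
    (H : ∀ x0 x1, A ((1 - l) * x0 + l * x1) ≤ (1 - l) * A0 x0 + l * A1 x1) (x0 x1 : ℝ) :
    PzT m v A ((1 - l) * x0 + l * x1)
      ≤ (1 - l) * PzT m0 v A0 x0 + l * PzT m1 v A1 x1 := by
  have iter : ∀ h : ℝ, 0 ≤ h → h ≤ 1 → ∀ k : ℕ, ∀ x0 x1,
      PzT m (k * h) A ((1 - l) * x0 + l * x1) ≤ (1 - l) * PzT m0 (k * h) A0 x0
        + l * PzT m1 (k * h) A1 x1 + k * ((C + 1) ^ 2 * pzK * h ^ 2) := by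
    intro h hh hh1 k
    induction k with
    | zero => intro x0 x1; simpa [pz_T_zero, h0, h1, hm] using H x0 x1
    | succ k ih =>
      intro x0 x1
      have hk : 0 ≤ (k : ℝ) * h := by positivity
      have := pz_step_small h0 h1 hm hm1 hl hml hh hh1 (by linarith : 0 ≤ C + 1)
        (pz_T_lip h0 _ hA0) (pz_T_lip h1 _ hA1) (pz_T_reg hm hm1 _ hA) ih x0 x1
      rw [pz_T_semigroup hm hh hk hA.2.1, pz_T_semigroup h0 hh hk hA0,
        pz_T_semigroup h1 hh hk hA1] at this
      have e : ((k + 1 : ℕ) : ℝ) * h = h + k * h := by push_cast; ring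
      rw [e]
      refine this.trans (le_of_eq ?_)
      push_cast
      ring
  have hlim : Tendsto (fun n : ℕ => (1 - l) * PzT m0 v A0 x0 + l * PzT m1 v A1 x1
      + ((C + 1) ^ 2 * pzK * v ^ 2) / (n : ℝ)) atTop
      (nhds ((1 - l) * PzT m0 v A0 x0 + l * PzT m1 v A1 x1 + 0)) :=
    tendsto_const_nhds.add (tendsto_const_div_atTop_nhds_zero_nat _)
  rw [add_zero] at hlim
  refine ge_of_tendsto hlim ?_
  filter_upwards [eventually_ge_atTop (⌈v⌉₊ + 1)] with n hn
  have hn' : v + 1 ≤ n := by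
    have : ((⌈v⌉₊ + 1 : ℕ) : ℝ) ≤ n := by exact_mod_cast hn
    push_cast at this
    linarith [Nat.le_ceil v]
  have hn0 : (0 : ℝ) < n := by linarith
  have := iter (v / n) (by positivity) (by rw [div_le_one hn0]; linarith) n x0 x1
  have e : (n : ℝ) * (v / n) = v := by field_simp
  rw [e] at this
  refine this.trans (le_of_eq ?_)
  congr 1
  field_simp

/-! ### Finitely supported measures on a common grid -/

lemma pz_xiD_mono {β : ℕ → ℝ} (hβ : ValidBeta β) {s t : ℝ} (hs : 0 ≤ s) (hst : s ≤ t)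
    (ht : t ≤ 1) : xiD β s ≤ xiD β t := by
  have hsum : ∀ r : ℝ, 0 ≤ r → r ≤ 1 →
      Summable fun p : ℕ => (p : ℝ) * β p ^ 2 * r ^ (p - 1) := by
    intro r hr hr1
    refine Summable.of_nonneg_of_le (fun p => by positivity) (fun p => ?_) hβ.2.2.2.2
    have h1 : (p : ℝ) ≤ 2 ^ p := by exact_mod_cast (Nat.lt_two_pow_self (n := p)).le
    have h2 : r ^ (p - 1) ≤ 1 := pow_le_one₀ hr hr1
    calc (p : ℝ) * β p ^ 2 * r ^ (p - 1) ≤ (p : ℝ) * β p ^ 2 * 1 :=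
          mul_le_mul_of_nonneg_left h2 (by positivity)
      _ = (p : ℝ) * β p ^ 2 := mul_one _
      _ ≤ _ := mul_le_mul_of_nonneg_right h1 (sq_nonneg _)
  refine Summable.tsum_le_tsum (fun p => ?_) (hsum s hs (hst.trans ht)) (hsum t (hs.trans hst) ht)
  exact mul_le_mul_of_nonneg_left (pow_le_pow_left₀ hs hst _) (by positivity)

/-- the convex combination of two measures -/
def PzMix (l : ℝ) (μ ν : Measure ℝ) : Measure ℝ :=
  ENNReal.ofReal (1 - l) • μ + ENNReal.ofReal l • ν

lemma pz_mix_apply (l : ℝ) (μ ν : Measure ℝ) (s : Set ℝ) :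
    PzMix l μ ν s = ENNReal.ofReal (1 - l) * μ s + ENNReal.ofReal l * ν s := by
  simp [PzMix]

lemma pz_mix_mem {l : ℝ} (hl : l ∈ Icc (0 : ℝ) 1) {μ ν : Measure ℝ} (hμ : MemM μ) (hν : MemM ν) :
    MemM (PzMix l μ ν) := by
  obtain ⟨h1, h2⟩ := hμ
  obtain ⟨h3, h4⟩ := hν
  refine ⟨⟨?_⟩, ?_⟩
  · rw [pz_mix_apply, measure_univ, measure_univ, mul_one, mul_one,
      ← ENNReal.ofReal_add (by linarith [hl.2]) hl.1]
    simp
  · rw [pz_mix_apply, h2, h4]; simp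

lemma pz_mix_distF {l : ℝ} (hl : l ∈ Icc (0 : ℝ) 1) {μ ν : Measure ℝ} (hμ : MemM μ)
    (hν : MemM ν) (s : ℝ) :
    distF (PzMix l μ ν) s = (1 - l) * distF μ s + l * distF ν s := by
  have := hμ.1
  have := hν.1
  rw [distF, pz_mix_apply, ENNReal.toReal_add (by finiteness) (by finiteness),
    ENNReal.toReal_mul, ENNReal.toReal_mul, ENNReal.toReal_ofReal (by linarith [hl.2]),
    ENNReal.toReal_ofReal hl.1]
  rfl

/-- measure with atoms exactly at the points of `S` -/
def PzGood (S : Finset ℝ) (μ : Measure ℝ) : Prop :=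
  MemM μ ∧ μ (S : Set ℝ)ᶜ = 0 ∧ ∀ q ∈ S, μ {q} ≠ 0

lemma pz_mix_good {S : Finset ℝ} {l : ℝ} (hl : l ∈ Icc (0 : ℝ) 1) {μ ν : Measure ℝ}
    (hμ : PzGood S μ) (hν : PzGood S ν) : PzGood S (PzMix l μ ν) := by
  refine ⟨pz_mix_mem hl hμ.1 hν.1, by rw [pz_mix_apply, hμ.2.1, hν.2.1]; simp, fun q hq => ?_⟩
  rw [pz_mix_apply]
  intro h
  rw [add_eq_zero, mul_eq_zero, mul_eq_zero, or_iff_left (hμ.2.2 q hq),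
    or_iff_left (hν.2.2 q hq), ENNReal.ofReal_eq_zero, ENNReal.ofReal_eq_zero] at h
  linarith [h.1, h.2]

lemma pz_mix_good' {S : Finset ℝ} {l : ℝ} (hl : l ∈ Icc (0 : ℝ) 1) (hl0 : 0 < l)
    {μ ν : Measure ℝ} (hμ : MemM μ) (hμS : μ (S : Set ℝ)ᶜ = 0) (hν : PzGood S ν) :
    PzGood S (PzMix l μ ν) := by
  refine ⟨pz_mix_mem hl hμ hν.1, by rw [pz_mix_apply, hμS, hν.2.1]; simp, fun q hq => ?_⟩
  rw [pz_mix_apply]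
  intro h
  rw [add_eq_zero, mul_eq_zero, mul_eq_zero, or_iff_left (hν.2.2 q hq),
    ENNReal.ofReal_eq_zero, ENNReal.ofReal_eq_zero] at h
  linarith [h.2]

lemma pz_distF_mem {μ : Measure ℝ} (hμ : MemM μ) (s : ℝ) : distF μ s ∈ Icc (0 : ℝ) 1 := by
  have := hμ.1
  refine ⟨ENNReal.toReal_nonneg, ?_⟩
  exact measureReal_le_one

lemma pz_distF_pos {S : Finset ℝ} (h0 : (0 : ℝ) ∈ S) {μ : Measure ℝ} (hμ : PzGood S μ) {s : ℝ}
    (hs : 0 ≤ s) : 0 < distF μ s := by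
  have := hμ.1.1
  refine ENNReal.toReal_pos (fun h => hμ.2.2 0 h0 ?_) (by finiteness)
  exact measure_mono_null (by simpa using hs) h

lemma pz_nextPt {S : Finset ℝ} (hS : ∀ q ∈ S, q ≤ 1) (h1 : (1 : ℝ) ∈ S) {μ : Measure ℝ}
    (hμ : PzGood S μ) {s t : ℝ} (ht : t ∈ S) (hst : s < t) (hs : s < 1)
    (hmin : ∀ q ∈ S, s < q → t ≤ q) : nextPt μ s = t := by
  apply IsLeast.csInf_eq
  refine ⟨Or.inl ⟨hst, hS t ht, hμ.2.2 t ht⟩, ?_⟩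
  rintro q (⟨hq1, hq2, hq3⟩ | hq)
  · refine hmin q ?_ hq1
    by_contra hqS
    exact hq3 (measure_mono_null (by simpa using hqS) hμ.2.1)
  · rw [mem_singleton_iff.1 hq]; exact hmin 1 h1 hs

lemma pz_sol_step {β : ℕ → ℝ} {S : Finset ℝ} (hS : ∀ q ∈ S, q ≤ 1) (h1 : (1 : ℝ) ∈ S)
    (h0 : (0 : ℝ) ∈ S) {μ : Measure ℝ}
    (hμ : PzGood S μ) {F : ℝ → ℝ → ℝ} (hF : IsAtomicSol β μ F) {s t : ℝ} (hs0 : 0 ≤ s)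
    (ht : t ∈ S) (hst : s < t) (hs : s < 1)
    (hmin : ∀ q ∈ S, s < q → t ≤ q) :
    F s = PzT (distF μ s) (xiD β t - xiD β s) (F t) := by
  ext x
  rw [hF.2 s ⟨hs0, hs⟩ x, pz_nextPt hS h1 hμ ht hst hs hmin, gStep,
    if_neg (pz_distF_pos h0 hμ hs0).ne', PzT]

lemma pz_finite {β : ℕ → ℝ} (hβ : ValidBeta β) {S : Finset ℝ} (hS : ∀ q ∈ S, q ≤ 1)
    (h1 : (1 : ℝ) ∈ S) (h0 : (0 : ℝ) ∈ S) {μ ν : Measure ℝ} (hμ : PzGood S μ) (hν : PzGood S ν)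
    {l : ℝ} (hl : l ∈ Icc (0 : ℝ) 1) {F0 F1 F : ℝ → ℝ → ℝ} (hF0 : IsAtomicSol β μ F0)
    (hF1 : IsAtomicSol β ν F1) (hF : IsAtomicSol β (PzMix l μ ν) F) :
    ∀ N : ℕ, ∀ s : ℝ, 0 ≤ s → s ≤ 1 → (S.filter (s < ·)).card ≤ N →
      ∃ C : ℝ, 0 ≤ C ∧ PzReg C (F s) ∧ PzLip (F0 s) ∧ PzLip (F1 s) ∧
        ∀ x0 x1, F s ((1 - l) * x0 + l * x1) ≤ (1 - l) * F0 s x0 + l * F1 s x1 := by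
  have base : ∃ C : ℝ, 0 ≤ C ∧ PzReg C (F 1) ∧ PzLip (F0 1) ∧ PzLip (F1 1) ∧
        ∀ x0 x1, F 1 ((1 - l) * x0 + l * x1) ≤ (1 - l) * F0 1 x0 + l * F1 1 x1 := by
    rw [show F 1 = fun x => Real.log (Real.cosh x) from funext hF.1,
      show F0 1 = fun x => Real.log (Real.cosh x) from funext hF0.1,
      show F1 1 = fun x => Real.log (Real.cosh x) from funext hF1.1]
    refine ⟨1, zero_le_one, pz_reg_logcosh, pz_reg_logcosh.2.1, pz_reg_logcosh.2.1,
      fun x0 x1 => ?_⟩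
    have := pz_reg_logcosh.1.2 (mem_univ x0) (mem_univ x1) (by linarith [hl.2] : 0 ≤ 1 - l) hl.1
      (by ring)
    simpa only [smul_eq_mul] using this
  intro N
  induction N with
  | zero =>
    intro s hs0 hs1 hN
    rcases hs1.eq_or_lt with rfl | hs
    · exact base
    · exfalso
      have : (1 : ℝ) ∈ S.filter (s < ·) := Finset.mem_filter.2 ⟨h1, hs⟩
      rw [Finset.card_eq_zero.1 (Nat.le_zero.1 hN)] at this
      simp at this
  | succ N ih =>
    intro s hs0 hs1 hN
    rcases hs1.eq_or_lt with rfl | hs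
    · exact base
    have hne : (S.filter (s < ·)).Nonempty := ⟨1, Finset.mem_filter.2 ⟨h1, hs⟩⟩
    set t := (S.filter (s < ·)).min' hne with ht
    obtain ⟨htS, hst⟩ := Finset.mem_filter.1 ((S.filter (s < ·)).min'_mem hne)
    rw [← ht] at htS hst
    have hmin : ∀ q ∈ S, s < q → t ≤ q := fun q hq hsq =>
      Finset.min'_le _ _ (Finset.mem_filter.2 ⟨hq, hsq⟩)
    have hcard : (S.filter (t < ·)).card ≤ N := by
      have : (S.filter (t < ·)).card < (S.filter (s < ·)).card := by
        apply Finset.card_lt_card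
        rw [Finset.ssubset_iff_of_subset]
        · exact ⟨t, Finset.mem_filter.2 ⟨htS, hst⟩, by simp⟩
        · intro q hq
          obtain ⟨hq1, hq2⟩ := Finset.mem_filter.1 hq
          exact Finset.mem_filter.2 ⟨hq1, hst.trans hq2⟩
      omega
    obtain ⟨C, hC, hR, hL0, hL1, H⟩ := ih t (hs0.trans hst.le) (hS t htS) hcard
    have hmix := pz_mix_good hl hμ hν
    rw [pz_sol_step hS h1 h0 hμ hF0 hs0 htS hst hs hmin,
      pz_sol_step hS h1 h0 hν hF1 hs0 htS hst hs hmin,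
      pz_sol_step hS h1 h0 hmix hF hs0 htS hst hs hmin]
    have p0 := pz_distF_pos h0 hμ hs0
    have p1 := pz_distF_pos h0 hν hs0
    have p := pz_distF_pos h0 hmix hs0
    have ple := (pz_distF_mem hmix.1 s).2
    refine ⟨C + 1, by linarith, pz_T_reg p ple _ hR, pz_T_lip p0 _ hL0, pz_T_lip p1 _ hL1, ?_⟩
    exact pz_step p0 p1 p ple hl (pz_mix_distF hl hμ.1 hν.1 s)
      (sub_nonneg.2 (pz_xiD_mono hβ hs0 hst.le (hS t htS))) hC hL0 hL1 hR H

/-! ### Approximation by measures on the grid -/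

/-- the grid `{k/(n+1)}` -/
def pzGrid (n : ℕ) : Finset ℝ :=
  (Finset.range (n + 2)).image (fun k : ℕ => (k : ℝ) / ((n : ℝ) + 1))

lemma pz_grid_sub (n : ℕ) : ∀ q ∈ pzGrid n, 0 ≤ q ∧ q ≤ 1 := by
  intro q hq
  obtain ⟨k, hk, rfl⟩ := Finset.mem_image.1 hq
  have : (k : ℝ) ≤ n + 1 := by
    have := Finset.mem_range.1 hk
    exact_mod_cast (by omega : k ≤ n + 1)
  exact ⟨by positivity, by rw [div_le_one (by positivity)]; exact this⟩

lemma pz_grid_zero (n : ℕ) : (0 : ℝ) ∈ pzGrid n :=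
  Finset.mem_image.2 ⟨0, by simp, by simp⟩

lemma pz_grid_one (n : ℕ) : (1 : ℝ) ∈ pzGrid n :=
  Finset.mem_image.2 ⟨n + 1, by simp, by
    push_cast
    exact div_self (by positivity)⟩

lemma pz_memM_of_grid {n : ℕ} {μ : Measure ℝ} (h : IsProbabilityMeasure μ)
    (hS : μ (pzGrid n : Set ℝ)ᶜ = 0) : MemM μ :=
  ⟨h, measure_mono_null (compl_subset_compl.2 fun q hq => pz_grid_sub n q hq) hS⟩

lemma pz_unif_good (n : ℕ) : PzGood (pzGrid n) (uniformOn (pzGrid n : Set ℝ)) := by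
  have hfin : (pzGrid n : Set ℝ).Finite := Finset.finite_toSet _
  have hne : (pzGrid n : Set ℝ).Nonempty := ⟨0, pz_grid_zero n⟩
  have hp := isProbabilityMeasure_uniformOn hfin hne
  have hS : uniformOn (pzGrid n : Set ℝ) (pzGrid n : Set ℝ)ᶜ = 0 := by
    rw [prob_compl_eq_zero_iff hfin.measurableSet]
    exact uniformOn_self hfin hne
  refine ⟨pz_memM_of_grid hp hS, hS, fun q hq h => ?_⟩
  rw [uniformOn_eq_zero_iff hfin] at h
  have : q ∈ (pzGrid n : Set ℝ) ∩ {q} := ⟨hq, rfl⟩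
  rw [h] at this
  exact this

/-- rounding down to the grid -/
def pzF (n : ℕ) (x : ℝ) : ℝ := (⌊((n : ℝ) + 1) * x⌋ : ℝ) / ((n : ℝ) + 1)

lemma pz_F_meas (n : ℕ) : Measurable (pzF n) := by
  unfold pzF
  have : Measurable fun x : ℝ => (⌊((n : ℝ) + 1) * x⌋ : ℤ) :=
    Int.measurable_floor.comp (by fun_prop)
  have h2 : Measurable fun k : ℤ => (k : ℝ) := measurable_from_top
  exact (h2.comp this).div_const _

lemma pz_F_grid (n : ℕ) {x : ℝ} (hx : x ∈ Icc (0 : ℝ) 1) : pzF n x ∈ pzGrid n := by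
  have hn : (0 : ℝ) < n + 1 := by positivity
  have h0 : 0 ≤ ⌊((n : ℝ) + 1) * x⌋ := Int.floor_nonneg.2 (mul_nonneg hn.le hx.1)
  have h1 : ⌊((n : ℝ) + 1) * x⌋ ≤ n + 1 := by
    have : (⌊((n : ℝ) + 1) * x⌋ : ℝ) ≤ n + 1 :=
      (Int.floor_le _).trans (by nlinarith [hx.2])
    exact_mod_cast this
  obtain ⟨k, hk⟩ := Int.eq_ofNat_of_zero_le h0
  refine Finset.mem_image.2 ⟨k, Finset.mem_range.2 (by omega), ?_⟩
  simp [pzF, hk]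

lemma pz_round {μ : Measure ℝ} (hμ : MemM μ) (n : ℕ) :
    IsProbabilityMeasure (μ.map (pzF n)) ∧ (μ.map (pzF n)) (pzGrid n : Set ℝ)ᶜ = 0 := by
  have := hμ.1
  refine ⟨Measure.isProbabilityMeasure_map (pz_F_meas n).aemeasurable, ?_⟩
  rw [Measure.map_apply (pz_F_meas n) (Finset.measurableSet _).compl]
  refine measure_mono_null (fun x hx hx' => hx (pz_F_grid n hx')) hμ.2

lemma pz_distF_mono {μ : Measure ℝ} (hμ : MemM μ) : Monotone (distF μ) := by
  have := hμ.1
  intro s t hst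
  exact ENNReal.toReal_mono (by finiteness) (measure_mono (Icc_subset_Icc_right hst))

lemma pz_round_distF {μ : Measure ℝ} (hμ : MemM μ) (n : ℕ) (s : ℝ) :
    distF μ s ≤ distF (μ.map (pzF n)) s ∧
      distF (μ.map (pzF n)) s ≤ distF μ (s + 1 / ((n : ℝ) + 1)) := by
  have := hμ.1
  have hn : (0 : ℝ) < n + 1 := by positivity
  have e : distF (μ.map (pzF n)) s = (μ (pzF n ⁻¹' Icc 0 s)).toReal := by
    rw [distF, Measure.map_apply (pz_F_meas n) measurableSet_Icc]
  rw [e]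
  constructor
  · refine ENNReal.toReal_mono (by finiteness) (measure_mono fun x hx => ⟨?_, ?_⟩)
    · have h0 : 0 ≤ ⌊((n : ℝ) + 1) * x⌋ := Int.floor_nonneg.2 (mul_nonneg hn.le hx.1)
      have h0' : (0 : ℝ) ≤ (⌊((n : ℝ) + 1) * x⌋ : ℝ) := by exact_mod_cast h0
      exact div_nonneg h0' hn.le
    · rw [pzF, div_le_iff₀ hn]
      have := Int.floor_le (((n : ℝ) + 1) * x)
      nlinarith [hx.2]
  · refine ENNReal.toReal_mono (by finiteness) (measure_mono fun x hx => ?_)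
    obtain ⟨h1, h2⟩ := hx
    rw [pzF] at h1 h2
    rw [div_le_iff₀ hn] at h2
    rw [le_div_iff₀ hn, zero_mul] at h1
    have h3 := Int.floor_le (((n : ℝ) + 1) * x)
    have h4 := Int.lt_floor_add_one (((n : ℝ) + 1) * x)
    constructor
    · by_contra hx
      push Not at hx
      nlinarith
    · have : x < s + 1 / ((n : ℝ) + 1) := by
        rw [← sub_lt_iff_lt_add', lt_div_iff₀ hn]
        nlinarith
      exact this.le

lemma pz_distF_right {μ : Measure ℝ} (hμ : MemM μ) {s : ℝ} (hs : 0 ≤ s) :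
    Tendsto (fun n : ℕ => distF μ (s + 1 / ((n : ℝ) + 1))) atTop (nhds (distF μ s)) := by
  have := hμ.1
  have e : ∀ t, 0 ≤ t → distF μ t = cdf μ t := by
    intro t ht
    rw [cdf_eq_real, distF, Measure.real]
    congr 1
    apply measure_congr
    have hsub : Iio (0 : ℝ) ⊆ (Icc (0 : ℝ) 1)ᶜ := fun x hx hx2 => not_lt.2 hx2.1 hx
    have h0 : μ (Iio 0) = 0 := measure_mono_null hsub hμ.2
    have h1 : ∀ᵐ x ∂μ, ¬ x < 0 := by
      rw [ae_iff]
      simp only [not_not]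
      exact h0
    filter_upwards [h1] with x hx
    apply propext
    change (0 ≤ x ∧ x ≤ t) ↔ x ≤ t
    exact ⟨fun h => h.2, fun h => ⟨not_lt.1 hx, h⟩⟩
  have hc := (cdf μ).right_continuous s
  have hseq : Tendsto (fun n : ℕ => s + 1 / ((n : ℝ) + 1)) atTop (nhdsWithin s (Ici s)) := by
    rw [tendsto_nhdsWithin_iff]
    refine ⟨?_, Eventually.of_forall fun n => ?_⟩
    · have h := (tendsto_const_nhds (x := s)).add (tendsto_one_div_add_atTop_nhds_zero_nat (𝕜 := ℝ))
      simpa using h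
    · have : (0 : ℝ) ≤ 1 / ((n : ℝ) + 1) := by positivity
      simp only [mem_Ici]
      linarith
  rw [e s hs]
  refine (hc.tendsto.comp hseq).congr fun n => ?_
  exact (e _ (by positivity)).symm

/-- the approximating measures -/
def pzApp (μ : Measure ℝ) (n : ℕ) : Measure ℝ :=
  PzMix (1 / ((n : ℝ) + 1)) (μ.map (pzF n)) (uniformOn (pzGrid n : Set ℝ))

lemma pz_eps (n : ℕ) : (1 / ((n : ℝ) + 1)) ∈ Icc (0 : ℝ) 1 := by
  refine ⟨by positivity, ?_⟩
  rw [div_le_one (by positivity)]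
  have : (0 : ℝ) ≤ n := by positivity
  linarith

lemma pz_app_good {μ : Measure ℝ} (hμ : MemM μ) (n : ℕ) : PzGood (pzGrid n) (pzApp μ n) := by
  obtain ⟨h1, h2⟩ := pz_round hμ n
  exact pz_mix_good' (pz_eps n) (by positivity) (pz_memM_of_grid h1 h2) h2 (pz_unif_good n)

lemma pz_app_tendsto {μ : Measure ℝ} (hμ : MemM μ) {s : ℝ} (hs : 0 ≤ s) :
    Tendsto (fun n => distF (pzApp μ n) s) atTop (nhds (distF μ s)) := by
  have e : ∀ n, distF (pzApp μ n) s = (1 - 1 / ((n : ℝ) + 1)) * distF (μ.map (pzF n)) s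
      + 1 / ((n : ℝ) + 1) * distF (uniformOn (pzGrid n : Set ℝ)) s := fun n => by
    obtain ⟨h1, h2⟩ := pz_round hμ n
    exact pz_mix_distF (pz_eps n) (pz_memM_of_grid h1 h2) (pz_unif_good n).1 s
  simp_rw [e]
  have h1 : Tendsto (fun n : ℕ => distF (μ.map (pzF n)) s) atTop (nhds (distF μ s)) :=
    tendsto_of_tendsto_of_tendsto_of_le_of_le tendsto_const_nhds (pz_distF_right hμ hs)
      (fun n => (pz_round_distF hμ n s).1) (fun n => (pz_round_distF hμ n s).2)
  have h2 := tendsto_one_div_add_atTop_nhds_zero_nat (𝕜 := ℝ)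
  have h3 : Tendsto (fun n : ℕ => 1 / ((n : ℝ) + 1) * distF (uniformOn (pzGrid n : Set ℝ)) s)
      atTop (nhds 0) := by
    refine squeeze_zero (fun n => ?_) (fun n => ?_) h2
    · exact mul_nonneg (pz_eps n).1 (pz_distF_mem (pz_unif_good n).1 s).1
    · exact mul_le_of_le_one_right (pz_eps n).1 (pz_distF_mem (pz_unif_good n).1 s).2
  have h4 := ((tendsto_const_nhds (x := (1 : ℝ))).sub h2 |>.mul h1).add h3
  simpa using h4

lemma pz_dM_tendsto {μ : Measure ℝ} (hμ : MemM μ) {ν : ℕ → Measure ℝ} (hν : ∀ n, MemM (ν n))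
    (h : ∀ s, 0 ≤ s → Tendsto (fun n => distF (ν n) s) atTop (nhds (distF μ s))) :
    Tendsto (fun n => dM μ (ν n)) atTop (nhds 0) := by
  have key : Tendsto (fun n => ∫ s in (0 : ℝ)..1, |distF μ s - distF (ν n) s|) atTop
      (nhds (∫ _s in (0 : ℝ)..1, (0 : ℝ))) := by
    refine intervalIntegral.tendsto_integral_filter_of_dominated_convergence (fun _ => 1)
      (Eventually.of_forall fun n => ?_) (Eventually.of_forall fun n => ?_) (by simp) ?_
    · exact ((pz_distF_mono hμ).measurable.sub
        (pz_distF_mono (hν n)).measurable).abs.aestronglyMeasurable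
    · refine ae_of_all _ fun s _ => ?_
      rw [Real.norm_eq_abs, abs_abs, abs_le]
      have h1 := pz_distF_mem hμ s
      have h2 := pz_distF_mem (hν n) s
      constructor <;> linarith [h1.1, h1.2, h2.1, h2.2]
    · refine ae_of_all _ fun s hs => ?_
      rw [uIoc_of_le zero_le_one] at hs
      have := ((tendsto_const_nhds (x := distF μ s)).sub (h s hs.1.le)).abs
      simpa using this
  simpa [dM] using key

lemma pz_Phi_tendsto {β : ℕ → ℝ} {Φ : Measure ℝ → ℝ → ℝ → ℝ} (hΦ : IsParisiFamily β Φ)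
    {μ : Measure ℝ} (hμ : MemM μ) {ν : ℕ → Measure ℝ} (hν : ∀ n, MemM (ν n))
    (h : ∀ s, 0 ≤ s → Tendsto (fun n => distF (ν n) s) atTop (nhds (distF μ s)))
    {s : ℝ} (hs : s ∈ Icc (0 : ℝ) 1) (x : ℝ) :
    Tendsto (fun n => Φ (ν n) s x) atTop (nhds (Φ μ s x)) := by
  rw [Metric.tendsto_atTop']
  intro ε hε
  obtain ⟨δ, hδ, H⟩ := hΦ.2 μ hμ ε hε
  have hev := (pz_dM_tendsto hμ hν h).eventually (gt_mem_nhds hδ)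
  obtain ⟨N, hN⟩ := eventually_atTop.1 hev
  refine ⟨N, fun n hn => ?_⟩
  rw [Real.dist_eq, abs_sub_comm]
  exact H (ν n) (hν n) (hN n hn.le) s hs x

/-- **Convexity of the Parisi PDE solution (Theorem 4(i)).** For any
`μ₀, μ₁ ∈ 𝓜`, `λ, s ∈ [0,1]` and `x₀, x₁ ∈ ℝ`,
`Φ_{μ_λ}(s, x_λ) ≤ (1-λ) Φ_{μ₀}(s, x₀) + λ Φ_{μ₁}(s, x₁)`. -/
theorem stmt16 (β : ℕ → ℝ) (hβ : ValidBeta β)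
    (Φ : Measure ℝ → ℝ → ℝ → ℝ) (hΦ : IsParisiFamily β Φ)
    (μ₀ μ₁ : Measure ℝ) (h₀ : MemM μ₀) (h₁ : MemM μ₁)
    (l s : ℝ) (hl : l ∈ Icc (0 : ℝ) 1) (hs : s ∈ Icc (0 : ℝ) 1) (x₀ x₁ : ℝ) :
    Φ (ENNReal.ofReal (1 - l) • μ₀ + ENNReal.ofReal l • μ₁) s ((1 - l) * x₀ + l * x₁)
      ≤ (1 - l) * Φ μ₀ s x₀ + l * Φ μ₁ s x₁ := by
  change Φ (PzMix l μ₀ μ₁) s ((1 - l) * x₀ + l * x₁) ≤ _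
  have g0 := pz_app_good h₀
  have g1 := pz_app_good h₁
  have g := fun n => pz_mix_good hl (g0 n) (g1 n)
  have t0 := pz_Phi_tendsto hΦ h₀ (fun n => (g0 n).1) (fun r hr => pz_app_tendsto h₀ hr) hs x₀
  have t1 := pz_Phi_tendsto hΦ h₁ (fun n => (g1 n).1) (fun r hr => pz_app_tendsto h₁ hr) hs x₁
  have t := pz_Phi_tendsto hΦ (pz_mix_mem hl h₀ h₁) (fun n => (g n).1) (fun r hr => by
    rw [pz_mix_distF hl h₀ h₁]
    simp_rw [fun n => pz_mix_distF hl (g0 n).1 (g1 n).1 r]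
    exact ((pz_app_tendsto h₀ hr).const_mul _).add ((pz_app_tendsto h₁ hr).const_mul _)) hs
    ((1 - l) * x₀ + l * x₁)
  refine le_of_tendsto_of_tendsto' t ((t0.const_mul (1 - l)).add (t1.const_mul l)) fun n => ?_
  obtain ⟨C, -, -, -, -, H⟩ := pz_finite hβ (fun q hq => (pz_grid_sub n q hq).2) (pz_grid_one n)
    (pz_grid_zero n) (g0 n) (g1 n) hl (hΦ.1 _ (g0 n).1 ⟨pzGrid n, (g0 n).2.1⟩)
    (hΦ.1 _ (g1 n).1 ⟨pzGrid n, (g1 n).2.1⟩) (hΦ.1 _ (g n).1 ⟨pzGrid n, (g n).2.1⟩)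
    _ s hs.1 hs.2 le_rfl
  exact H x₀ x₁

end
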